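/- arXiv:1303.6448 — 2 statements merged into one kernel-verified Lean document; each statement's English description precedes it below -/
import Mathlib

section
/- There exists a smooth map f from the unit sphere S² = {x ∈ ℝ³ : ‖x‖ = 1} (with its standard smooth manifold structure) to ℝ³ such that (i) f(-x) = f(x) for every x ∈ S², and (ii) for every x ∈ S² the differential (mfderiv) of f at x is injective. (Such an f descends to a smooth immersion of the real projective plane ℝP² into ℝ³; this is Boy's theorem that ℝP² can be immersed in ℝ³.) -/
open Metric Manifold

theorem boy_pos (P Q R z : ℝ) (hrho : 0 < R) (hs : R + z ^ 2 = 1)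
    (hPQ : P ^ 2 + Q ^ 2 = R ^ 3) (hz : z * R = P / 2)
    (key : 3 * P ^ 2 + Q ^ 2 - 2 * Q ^ 2 * z ^ 2 + 2 * Q * z = 0) : False := by
  have hR1 : R ≤ 1 := by linarith [sq_nonneg z]
  have hP2 : P ^ 2 = 4 * (z ^ 2 * R ^ 2) := by
    linear_combination (-4) * (z * R + P / 2) * hz
  have hz2 : z ^ 2 ≤ R / 4 := by
    have h6 : z ^ 2 * R ^ 2 ≤ R / 4 * R ^ 2 := by
      have : R / 4 * R ^ 2 = R ^ 3 / 4 := by ring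
      linarith [sq_nonneg Q]
    exact le_of_mul_le_mul_right h6 (by positivity)
  have hz5 : z ^ 2 ≤ 1 / 5 := by linarith
  have hR5 : 4 / 5 ≤ R := by linarith
  have h8 : (16 : ℝ) / 25 ≤ R ^ 2 := by nlinarith
  have h7 := mul_le_mul_of_nonneg_left h8 (sq_nonneg z)
  have h9 : Q ^ 2 * z ^ 2 ≤ Q ^ 2 * (1 / 5) := mul_le_mul_of_nonneg_left hz5 (sq_nonneg Q)
  have h10 : 0 < P ^ 2 + Q ^ 2 := by rw [hPQ]; positivity
  have h11 : 0 ≤ Q ^ 2 / 4 + 2 * Q * z + 4 * z ^ 2 := by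
    have := sq_nonneg (Q / 2 + 2 * z)
    linarith [this, show (Q / 2 + 2 * z) ^ 2 = Q ^ 2 / 4 + 2 * Q * z + 4 * z ^ 2 by ring]
  linarith [sq_nonneg P, sq_nonneg Q]

/-- The algebraic heart: a tangent vector killed by the differential vanishes. -/
theorem boy_alg (x y z p q r L : ℝ) (hs : x ^ 2 + y ^ 2 + z ^ 2 = 1)
    (ho : x * p + y * q + z * r = 0)
    (h1 : (x * p - y * q) / 2 + (r * x + z * p) = L * ((x ^ 2 - y ^ 2) / 4 + z * x))
    (h2 : (x * q + y * p) / 2 - (r * y + z * q) = L * (x * y / 2 - z * y))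
    (h3 : 2 * (x * p + y * q) = L * (x ^ 2 + y ^ 2))
    (h4 : r * (3 * x ^ 2 * y - y ^ 3) + z * (6 * x * y * p + 3 * x ^ 2 * q - 3 * y ^ 2 * q)
      = L * (1 + z * (3 * x ^ 2 * y - y ^ 3))) : p = 0 ∧ q = 0 ∧ r = 0 := by
  by_cases hr0 : x ^ 2 + y ^ 2 = 0
  · have hx : x = 0 := by nlinarith [sq_nonneg x, sq_nonneg y]
    have hy : y = 0 := by nlinarith [sq_nonneg x, sq_nonneg y]
    subst hx hy
    have hz : z ≠ 0 := by rintro rfl; norm_num at hs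
    refine ⟨?_, ?_, ?_⟩
    · have : z * p = 0 := by linarith
      simpa [hz] using this
    · have : z * q = 0 := by linarith
      simpa [hz] using this
    · have : z * r = 0 := by linarith
      simpa [hz] using this
  have hrho : 0 < x ^ 2 + y ^ 2 := lt_of_le_of_ne (by positivity) (Ne.symm hr0)
  obtain ⟨m, hm⟩ : ∃ m, m * (x ^ 2 + y ^ 2) = x * q - y * p :=
    ⟨(x * q - y * p) / (x ^ 2 + y ^ 2), by field_simp⟩
  obtain ⟨k, hk⟩ : ∃ k, r = L / 2 * z + k := ⟨r - L / 2 * z, by ring⟩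
  have hp : p = L / 2 * x - m * y := by
    apply mul_left_cancel₀ hr0
    linear_combination x / 2 * h3 + y * hm
  have hq : q = L / 2 * y + m * x := by
    apply mul_left_cancel₀ hr0
    linear_combination y / 2 * h3 - x * hm
  subst hp hq hk
  have hL : L = -2 * k * z := by linear_combination 2 * ho - L * hs
  obtain ⟨P, hP⟩ : ∃ P, P = x ^ 3 - 3 * x * y ^ 2 := ⟨_, rfl⟩
  obtain ⟨Q, hQ⟩ : ∃ Q, Q = 3 * x ^ 2 * y - y ^ 3 := ⟨_, rfl⟩
  obtain ⟨R, hR⟩ : ∃ R, R = x ^ 2 + y ^ 2 := ⟨_, rfl⟩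
  have hPQ : P ^ 2 + Q ^ 2 = R ^ 3 := by subst hP hQ hR; ring
  have hre : k * R = m * Q / 2 := by
    subst hQ hR; linear_combination x * h1 - y * h2
  have him : m * (P / 2 - z * R) = 0 := by
    subst hP hR; linear_combination x * h2 + y * h1
  have h4' : L * z * Q + 3 * m * z * P + k * Q = L := by
    subst hP hQ; linear_combination h4
  rw [← hR] at hrho hr0 hs
  by_cases hm0 : m = 0
  · subst hm0
    have hk0 : k = 0 := by
      have : k * R = 0 := by linarith
      simpa [hr0] using this
    subst hk0
    have hL0 : L = 0 := by linarith
    subst hL0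
    simp
  exfalso
  have hz : z * R = P / 2 := by
    have := (mul_eq_zero.mp him).resolve_left hm0
    linarith
  have key : 3 * P ^ 2 + Q ^ 2 - 2 * Q ^ 2 * z ^ 2 + 2 * Q * z = 0 := by
    have h5 : m * (3 * P ^ 2 + Q ^ 2 - 2 * Q ^ 2 * z ^ 2 + 2 * Q * z) = 0 := by
      rw [hL] at h4'
      linear_combination 2 * R * h4' - 6 * m * P * hz +
        (4 * z ^ 2 * Q - 2 * Q - 4 * z) * hre
    exact (mul_eq_zero.mp h5).resolve_left hm0
  exact boy_pos P Q R z hrho hs hPQ hz key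

theorem boy_den (x y z : ℝ) (hs : x ^ 2 + y ^ 2 + z ^ 2 = 1) :
    0 < 1 + z * (3 * x ^ 2 * y - y ^ 3) := by
  have h : (3 * x ^ 2 * y - y ^ 3) ^ 2 ≤ (x ^ 2 + y ^ 2) ^ 3 := by
    nlinarith [sq_nonneg (x ^ 3 - 3 * x * y ^ 2)]
  have h1 : (x ^ 2 + y ^ 2) ^ 3 ≤ x ^ 2 + y ^ 2 := by
    have h0 : 0 ≤ x ^ 2 + y ^ 2 := by positivity
    have h2 : x ^ 2 + y ^ 2 ≤ 1 := by nlinarith [sq_nonneg z]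
    exact pow_le_of_le_one h0 h2 (by norm_num)
  nlinarith [sq_nonneg (z + (3 * x ^ 2 * y - y ^ 3))]

/-- Denominator. -/
noncomputable def boyD (v : EuclideanSpace ℝ (Fin 3)) : ℝ :=
  1 + v 2 * (3 * v 0 ^ 2 * v 1 - v 1 ^ 3)

/-- The Boy surface map on the ambient space. -/
noncomputable def boyF (v : EuclideanSpace ℝ (Fin 3)) : EuclideanSpace ℝ (Fin 3) :=
  !₂[((v 0 ^ 2 - v 1 ^ 2) / 4 + v 2 * v 0) / boyD v,
     (v 0 * v 1 / 2 - v 2 * v 1) / boyD v,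
     (v 0 ^ 2 + v 1 ^ 2) / boyD v]

theorem boy_sphere (x : EuclideanSpace ℝ (Fin 3)) (hx : x ∈ sphere (0 : EuclideanSpace ℝ (Fin 3)) 1) :
    x 0 ^ 2 + x 1 ^ 2 + x 2 ^ 2 = 1 := by
  have h : ‖x‖ ^ 2 = 1 := by
    rw [mem_sphere_zero_iff_norm.mp hx]; norm_num
  rw [EuclideanSpace.norm_sq_eq] at h
  simpa [Fin.sum_univ_three] using h

theorem boyF_contDiffAt (x : EuclideanSpace ℝ (Fin 3)) (hx : boyD x ≠ 0) :
    ContDiffAt ℝ (⊤ : ℕ∞) boyF x := by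
  have hD : ContDiffAt ℝ (⊤ : ℕ∞) boyD x := by unfold boyD; fun_prop
  rw [contDiffAt_euclidean]
  intro i
  fin_cases i
  · simp only [boyF]
    exact ContDiffAt.div (by fun_prop) hD hx
  · simp only [boyF]
    exact ContDiffAt.div (by fun_prop) hD hx
  · simp only [boyF]
    exact ContDiffAt.div (by fun_prop) hD hx

theorem boy_quot {N D : ℝ → ℝ} {n d : ℝ} (hN : HasDerivAt N n 0) (hD : HasDerivAt D d 0)
    (h0 : D 0 ≠ 0) (h : HasDerivAt (fun t => N t / D t) 0 0) :
    n = d / D 0 * N 0 := by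
  have := (hN.div hD h0).unique h
  field_simp at this ⊢
  linarith

theorem boyF_inj (x v : EuclideanSpace ℝ (Fin 3))
    (hx : x ∈ sphere (0 : EuclideanSpace ℝ (Fin 3)) 1)
    (hv : inner ℝ x v = 0) (h : fderiv ℝ boyF x v = 0) : v = 0 := by
  have hs := boy_sphere x hx
  have hpos := boy_den _ _ _ hs
  have hD0 : boyD x ≠ 0 := hpos.ne'
  have hF := ((boyF_contDiffAt x hD0).differentiableAt (by simp)).hasFDerivAt
  have hl : HasDerivAt (fun t : ℝ => x + t • v) v 0 := by
    simpa using ((hasDerivAt_id (0 : ℝ)).smul_const v).const_add x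
  have hc : HasDerivAt (fun t : ℝ => boyF (x + t • v)) 0 0 := by
    rw [← h]
    exact HasFDerivAt.comp_hasDerivAt (0 : ℝ) (by simpa using hF) hl
  have hi : ∀ i, HasDerivAt (fun t : ℝ => boyF (x + t • v) i) 0 0 := fun i => by
    exact (EuclideanSpace.proj i : EuclideanSpace ℝ (Fin 3) →L[ℝ] ℝ).hasFDerivAt.comp_hasDerivAt (0 : ℝ) hc
  have hX : ∀ i, HasDerivAt (fun t : ℝ => (x + t • v) i) (v i) 0 := fun i =>
    (EuclideanSpace.proj i : EuclideanSpace ℝ (Fin 3) →L[ℝ] ℝ).hasFDerivAt.comp_hasDerivAt (0 : ℝ) hl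
  have hD : HasDerivAt (fun t : ℝ => boyD (x + t • v)) _ 0 :=
    ((hX 2).mul (((((hX 0).pow 2).const_mul 3).mul (hX 1)).sub ((hX 1).pow 3))).const_add 1
  have e1 := boy_quot (((((hX 0).pow 2).sub ((hX 1).pow 2)).div_const 4).add
    ((hX 2).mul (hX 0))) hD (by simpa using hD0) (hi 0)
  have e2 := boy_quot ((((hX 0).mul (hX 1)).div_const 2).sub
    ((hX 2).mul (hX 1))) hD (by simpa using hD0) (hi 1)
  have e3 := boy_quot (((hX 0).pow 2).add ((hX 1).pow 2)) hD (by simpa using hD0) (hi 2)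
  obtain ⟨d, hd⟩ : ∃ d, d = v 2 * (3 * x 0 ^ 2 * x 1 - x 1 ^ 3) + x 2 * (6 * x 0 * x 1 * v 0
    + 3 * x 0 ^ 2 * v 1 - 3 * x 1 ^ 2 * v 1) := ⟨_, rfl⟩
  simp [-mul_eq_mul_left_iff] at e1 e2 e3 hD
  have ho : x 0 * v 0 + x 1 * v 1 + x 2 * v 2 = 0 := by
    simp [PiLp.inner_apply, Fin.sum_univ_three] at hv
    linarith
  have hdd := hd
  obtain ⟨a, b, c⟩ := boy_alg (x 0) (x 1) (x 2) (v 0) (v 1) (v 2) (d / boyD x) hs ho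
    (by rw [hd]; ring_nf at e1 ⊢; linarith) (by rw [hd]; ring_nf at e2 ⊢; linarith)
    (by rw [hd]; ring_nf at e3 ⊢; linarith)
    (by rw [← hd]; change d = d / boyD x * boyD x; field_simp)
  ext i
  fin_cases i <;> simpa

/-- **Boy's theorem** (immersion form): there is a smooth map from the unit
sphere `S² ⊆ ℝ³` to `ℝ³` that is invariant under the antipodal map and whose
manifold differential is injective at every point.  Such a map descends to a
smooth immersion of the real projective plane `ℝP²` into `ℝ³`. -/
theorem boy_surface_immersion :
    ∃ f : (sphere (0 : EuclideanSpace ℝ (Fin 3)) 1) → EuclideanSpace ℝ (Fin 3),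
      ContMDiff (𝓡 2) 𝓘(ℝ, EuclideanSpace ℝ (Fin 3)) (⊤ : ℕ∞) f ∧
      (∀ x : sphere (0 : EuclideanSpace ℝ (Fin 3)) 1, f (-x) = f x) ∧
      (∀ x : sphere (0 : EuclideanSpace ℝ (Fin 3)) 1,
        Function.Injective (mfderiv (𝓡 2) 𝓘(ℝ, EuclideanSpace ℝ (Fin 3)) f x)) := by
  haveI : Fact (Module.finrank ℝ (EuclideanSpace ℝ (Fin 3)) = 2 + 1) :=
    Fact.mk (@finrank_euclideanSpace_fin ℝ _ 3)
  have hne : ∀ x : sphere (0 : EuclideanSpace ℝ (Fin 3)) 1, boyD x ≠ 0 := fun x =>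
    (boy_den _ _ _ (boy_sphere x x.2)).ne'
  have hcoe : ContMDiff (𝓡 2) 𝓘(ℝ, EuclideanSpace ℝ (Fin 3)) (⊤ : ℕ∞)
    ((↑) : sphere (0 : EuclideanSpace ℝ (Fin 3)) 1 → EuclideanSpace ℝ (Fin 3)) :=
    contMDiff_coe_sphere
  refine ⟨boyF ∘ (↑), ?_, ?_, ?_⟩
  · intro x
    exact (boyF_contDiffAt x (hne x)).contMDiffAt.comp x (hcoe x)
  · intro x
    have hD : boyD (-(x : EuclideanSpace ℝ (Fin 3))) = boyD x := by
      simp only [boyD, PiLp.neg_apply]; ring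
    simp only [Function.comp, boyF, coe_neg_sphere, hD]
    simp
  · intro x
    have hFd := (boyF_contDiffAt x (hne x)).differentiableAt (by simp)
    rw [mfderiv_comp x hFd.mdifferentiableAt ((hcoe x).mdifferentiableAt (by simp)),
      mfderiv_eq_fderiv]
    refine (injective_iff_map_eq_zero _).mpr fun u hu => ?_
    have hmem : (mfderiv (𝓡 2) 𝓘(ℝ, EuclideanSpace ℝ (Fin 3))
        ((↑) : sphere (0 : EuclideanSpace ℝ (Fin 3)) 1 → EuclideanSpace ℝ (Fin 3)) x u :
        EuclideanSpace ℝ (Fin 3)) ∈ (ℝ ∙ (x : EuclideanSpace ℝ (Fin 3)))ᗮ := by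
      rw [← range_mfderiv_coe_sphere (n := 2) x]
      exact ⟨u, rfl⟩
    have h0 := boyF_inj x _ x.2 (Submodule.mem_orthogonal_singleton_iff_inner_right.mp hmem) hu
    exact (injective_iff_map_eq_zero _).mp (mfderiv_coe_sphere_injective (n := 2) x) u h0
end

section
/- There exists a continuous map g from the real projective plane ℝP² (the projectivization of ℝ³, i.e. the quotient of ℝ³ \ {0} identifying proportional vectors, with the quotient topology) to ℝ³ that is locally injective: every point of ℝP² has an open neighborhood on which g is injective. (This is the topological content of Boy's immersion of ℝP² into ℝ³.) -/
open Projectivization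
open scoped LinearAlgebra.Projectivization

/-- The quotient topology on the real projective plane `ℝP²`, viewed as the
projectivization of `ℝ³` (the quotient of `ℝ³ \ {0}` identifying proportional
vectors). -/
noncomputable instance : TopologicalSpace (ℙ ℝ (EuclideanSpace ℝ (Fin 3))) :=
  inferInstanceAs
    (TopologicalSpace (Quotient (projectivizationSetoid ℝ (EuclideanSpace ℝ (Fin 3)))))

set_option linter.unusedVariables false

/-- A nonnegative weighted square. -/
noncomputable def wsq (c : ℕ) (t : ℝ) : ℝ := (c : ℝ) * t ^ 2

theorem wsq_nonneg (c : ℕ) (t : ℝ) : 0 ≤ wsq c t := by unfold wsq; positivity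

/-- Part 0 of the sum-of-squares certificate. -/
noncomputable def bs0 (m0 m1 m2 m3 m4 m5 m6 m7 m8 m9 m10 m11 m12 m13 m14 m15 m16 m17 m18 m19 m20 : ℝ) : ℝ :=
  wsq 1 (25*m0 - 22*m1 + 7*m2 - 33*m3 - 4*m4 - 9*m5 + 22*m6 + 12*m7 - 18*m8 - 7*m9 - 3*m10 - 11*m11 + 25*m12 + 18*m13 - 2*m14 - 6*m15 - 7*m17 + 3*m18 - m19 - 6*m20) + wsq 1 (58*m1 - 7*m2 + 54*m3 + 9*m4 - 2*m5 - 13*m6 - 16*m7 + 8*m8 + 27*m9 + 2*m10 + 31*m11 - 3*m12 - 6*m13 + 11*m14 - 3*m15 + 12*m16 + 9*m17 + 12*m18 + 2*m19 - 2*m20) + wsq 1 (34*m2 - 4*m3 - 2*m4 - 7*m5 + 4*m6 + 4*m7 - 8*m8 + 5*m9 - m10 - 7*m11 + 11*m13 + 8*m14 - m15 + 7*m16 + 18*m17 - 3*m18 - m19 - m20) + wsq 1 (58*m3 - 18*m4 + 10*m5 - m6 + 8*m7 + 5*m8 - 13*m9 - 5*m10 + 25*m11 - 16*m12 + 9*m13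 + m14 - 4*m15 + 19*m16 + 5*m17 - 14*m18 + 6*m19 - 4*m20)
    + wsq 1 (67*m4 - 11*m5 - 3*m6 - 18*m7 - 4*m8 + 46*m9 + 6*m10 - 12*m11 + 18*m12 - 9*m13 + 29*m14 + 6*m15 - 7*m16 - 6*m17 + 11*m18 - 7*m19 - 6*m20) + wsq 1 (52*m5 - 7*m6 + 4*m7 + 14*m8 - 17*m9 - 2*m10 + 12*m11 - 11*m12 - 7*m13 - 17*m14 + 2*m15 + 8*m16 - 6*m17 - 5*m18 + 5*m19 + 9*m20) + wsq 1 (48*m6 + 11*m7 - 11*m8 + 5*m9 - 4*m10 - 2*m11 - 5*m12 + 10*m13 + 16*m14 - 2*m15 + 5*m16 + 19*m17 - 9*m18 - 2*m19 + 5*m20)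

theorem bs0_nonneg (m0 m1 m2 m3 m4 m5 m6 m7 m8 m9 m10 m11 m12 m13 m14 m15 m16 m17 m18 m19 m20 : ℝ) :
    0 ≤ bs0 m0 m1 m2 m3 m4 m5 m6 m7 m8 m9 m10 m11 m12 m13 m14 m15 m16 m17 m18 m19 m20 := by
  unfold bs0
  repeat (first | exact wsq_nonneg _ _ | refine add_nonneg ?_ (wsq_nonneg _ _))

/-- Part 1 of the sum-of-squares certificate. -/
noncomputable def bs1 (m0 m1 m2 m3 m4 m5 m6 m7 m8 m9 m10 m11 m12 m13 m14 m15 m16 m17 m18 m19 m20 : ℝ) : ℝ :=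
  wsq 1 (56*m7 - 4*m8 - 9*m9 - 4*m10 + m11 - 7*m12 + 12*m13 - 2*m14 - 5*m15 + 12*m16 + 20*m17 - 10*m18 + m19 + 9*m20) + wsq 1 (57*m8 - 11*m9 + 2*m10 + 8*m11 + 2*m12 - 15*m13 - 13*m14 + 9*m15 - 15*m16 - 28*m17 + 6*m18 + 2*m19 + 3*m20) + wsq 1 (62*m9 + m10 - 2*m11 + 6*m12 + m13 + 26*m14 - 5*m15 + 15*m16 + 9*m17 - 4*m18 - 5*m19 - 6*m20) + wsq 1 (34*m10 - 3*m11 + 4*m12 - 8*m13 - m14 + 2*m15 - 11*m16 - 15*m17 + 4*m18 + m20)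
    + wsq 1 (52*m11 - 7*m12 - 11*m13 - 6*m14 - m15 - 4*m16 - 11*m17 - 6*m18 + 3*m19 + 7*m20) + wsq 1 (51*m12 - 6*m13 + 3*m14 + 5*m15 - 11*m16 - 6*m17 + 7*m18 - 2*m19) + wsq 1 (59*m13 + 6*m14 + 3*m15 + 20*m16 + 37*m17 - 5*m18 - 3*m19)

theorem bs1_nonneg (m0 m1 m2 m3 m4 m5 m6 m7 m8 m9 m10 m11 m12 m13 m14 m15 m16 m17 m18 m19 m20 : ℝ) :
    0 ≤ bs1 m0 m1 m2 m3 m4 m5 m6 m7 m8 m9 m10 m11 m12 m13 m14 m15 m16 m17 m18 m19 m20 := by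
  unfold bs1
  repeat (first | exact wsq_nonneg _ _ | refine add_nonneg ?_ (wsq_nonneg _ _))

/-- Part 2 of the sum-of-squares certificate. -/
noncomputable def bs2 (m0 m1 m2 m3 m4 m5 m6 m7 m8 m9 m10 m11 m12 m13 m14 m15 m16 m17 m18 m19 m20 : ℝ) : ℝ :=
  wsq 1 (36*m14 + 4*m15 + 2*m16 + 12*m17 - 4*m18 - 2*m19 - m20) + wsq 1 (18*m15 - 6*m16 - 23*m17 + 18*m18 - 2*m19 - 10*m20) + wsq 1 (42*m16 + 33*m17 - 8*m18 + 2*m19 - 2*m20) + wsq 1 (41*m17 + 2*m18 + m19 - 9*m20)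
    + wsq 1 (42*m18 - 3*m19 + 4*m20) + wsq 1 (33*m19 + 2*m20) + wsq 1 (8*m20)

theorem bs2_nonneg (m0 m1 m2 m3 m4 m5 m6 m7 m8 m9 m10 m11 m12 m13 m14 m15 m16 m17 m18 m19 m20 : ℝ) :
    0 ≤ bs2 m0 m1 m2 m3 m4 m5 m6 m7 m8 m9 m10 m11 m12 m13 m14 m15 m16 m17 m18 m19 m20 := by
  unfold bs2
  repeat (first | exact wsq_nonneg _ _ | refine add_nonneg ?_ (wsq_nonneg _ _))

/-- Part 3 of the sum-of-squares certificate. -/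
noncomputable def bs3 (m0 m1 m2 m3 m4 m5 m6 m7 m8 m9 m10 m11 m12 m13 m14 m15 m16 m17 m18 m19 m20 : ℝ) : ℝ :=
  wsq 1 (m1 + m0) + wsq 4 (m2 - m0) + wsq 16 (m2 - m1) + wsq 3 (m3 - m0)
    + wsq 42 (m3 - m1) + wsq 11 (m3 - m2) + wsq 8 (m4 - m0) + wsq 2 (m4 + m1)
    + wsq 21 (m4 - m2) + wsq 14 (m4 - m3) + wsq 9 (m5 - m0) + wsq 10 (m5 - m1)
    + wsq 1 (m5 - m2) + wsq 5 (m5 - m3) + wsq 21 (m5 + m4) + wsq 8 (m6 + m0)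
    + wsq 22 (m6 - m1) + wsq 15 (m6 + m2) + wsq 46 (m6 - m3) + wsq 36 (m6 - m4)
    + wsq 1 (m6 + m5) + wsq 3 (m7 - m0) + wsq 4 (m7 + m1) + wsq 8 (m7 - m2)
    + wsq 16 (m7 - m3) + wsq 38 (m7 + m4) + wsq 14 (m7 + m5) + wsq 10 (m7 + m6)
    + wsq 9 (m8 + m0) + wsq 4 (m8 + m1) + wsq 14 (m8 - m2) + wsq 16 (m8 - m3)
    + wsq 18 (m8 + m4) + wsq 20 (m8 + m5) + wsq 1 (m8 - m6) + wsq 23 (m8 - m7)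
    + wsq 5 (m9 - m0) + wsq 8 (m9 + m1) + wsq 4 (m9 - m2) + wsq 21 (m9 + m3)

theorem bs3_nonneg (m0 m1 m2 m3 m4 m5 m6 m7 m8 m9 m10 m11 m12 m13 m14 m15 m16 m17 m18 m19 m20 : ℝ) :
    0 ≤ bs3 m0 m1 m2 m3 m4 m5 m6 m7 m8 m9 m10 m11 m12 m13 m14 m15 m16 m17 m18 m19 m20 := by
  unfold bs3
  repeat (first | exact wsq_nonneg _ _ | refine add_nonneg ?_ (wsq_nonneg _ _))

/-- Part 4 of the sum-of-squares certificate. -/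
noncomputable def bs4 (m0 m1 m2 m3 m4 m5 m6 m7 m8 m9 m10 m11 m12 m13 m14 m15 m16 m17 m18 m19 m20 : ℝ) : ℝ :=
  wsq 49 (m9 - m4) + wsq 2 (m9 - m5) + wsq 37 (m9 - m6) + wsq 37 (m9 + m7)
    + wsq 3 (m9 + m8) + wsq 12 (m10 + m0) + wsq 2 (m10 - m1) + wsq 3 (m10 - m2)
    + wsq 7 (m10 + m3) + wsq 16 (m10 + m4) + wsq 10 (m10 + m5) + wsq 1 (m10 - m6)
    + wsq 28 (m10 + m7) + wsq 5 (m10 + m8) + wsq 3 (m10 + m9) + wsq 13 (m11 - m0)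
    + wsq 24 (m11 - m1) + wsq 8 (m11 - m2) + wsq 13 (m11 + m3) + wsq 17 (m11 + m4)
    + wsq 12 (m11 - m5) + wsq 22 (m11 - m6) + wsq 22 (m11 - m7) + wsq 15 (m11 + m8)
    + wsq 1 (m11 + m9) + wsq 23 (m11 + m10) + wsq 14 (m12 + m0) + wsq 4 (m12 + m1)
    + wsq 16 (m12 - m2) + wsq 7 (m12 + m3) + wsq 35 (m12 - m4) + wsq 3 (m12 - m5)
    + wsq 8 (m12 + m6) + wsq 19 (m12 + m7) + wsq 7 (m12 + m8) + wsq 23 (m12 - m9)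
    + wsq 1 (m12 + m10) + wsq 27 (m12 - m11) + wsq 24 (m13 + m1) + wsq 2 (m13 - m2)

theorem bs4_nonneg (m0 m1 m2 m3 m4 m5 m6 m7 m8 m9 m10 m11 m12 m13 m14 m15 m16 m17 m18 m19 m20 : ℝ) :
    0 ≤ bs4 m0 m1 m2 m3 m4 m5 m6 m7 m8 m9 m10 m11 m12 m13 m14 m15 m16 m17 m18 m19 m20 := by
  unfold bs4
  repeat (first | exact wsq_nonneg _ _ | refine add_nonneg ?_ (wsq_nonneg _ _))

/-- Part 5 of the sum-of-squares certificate. -/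
noncomputable def bs5 (m0 m1 m2 m3 m4 m5 m6 m7 m8 m9 m10 m11 m12 m13 m14 m15 m16 m17 m18 m19 m20 : ℝ) : ℝ :=
  wsq 8 (m13 + m3) + wsq 13 (m13 + m4) + wsq 30 (m13 - m5) + wsq 15 (m13 + m6)
    + wsq 12 (m13 - m7) + wsq 22 (m13 - m8) + wsq 44 (m13 + m9) + wsq 11 (m13 + m10)
    + wsq 10 (m13 - m11) + wsq 5 (m14 + m0) + wsq 2 (m14 + m1) + wsq 1 (m14 - m2)
    + wsq 20 (m14 - m3) + wsq 7 (m14 - m5) + wsq 32 (m14 - m6) + wsq 34 (m14 - m7)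
    + wsq 10 (m14 + m8) + wsq 2 (m14 + m9) + wsq 11 (m14 + m10) + wsq 1 (m14 - m11)
    + wsq 1 (m14 - m12) + wsq 8 (m14 - m13) + wsq 6 (m15 + m0) + wsq 3 (m15 - m1)
    + wsq 19 (m15 + m2) + wsq 12 (m15 + m3) + wsq 23 (m15 - m4) + wsq 16 (m15 + m5)
    + wsq 13 (m15 - m6) + wsq 21 (m15 + m7) + wsq 8 (m15 + m8) + wsq 47 (m15 - m9)
    + wsq 3 (m15 - m10) + wsq 37 (m15 + m11) + wsq 15 (m15 - m12) + wsq 5 (m15 - m13)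
    + wsq 19 (m15 - m14) + wsq 12 (m16 - m1) + wsq 10 (m16 - m2) + wsq 6 (m16 + m3)

theorem bs5_nonneg (m0 m1 m2 m3 m4 m5 m6 m7 m8 m9 m10 m11 m12 m13 m14 m15 m16 m17 m18 m19 m20 : ℝ) :
    0 ≤ bs5 m0 m1 m2 m3 m4 m5 m6 m7 m8 m9 m10 m11 m12 m13 m14 m15 m16 m17 m18 m19 m20 := by
  unfold bs5
  repeat (first | exact wsq_nonneg _ _ | refine add_nonneg ?_ (wsq_nonneg _ _))

/-- Part 6 of the sum-of-squares certificate. -/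
noncomputable def bs6 (m0 m1 m2 m3 m4 m5 m6 m7 m8 m9 m10 m11 m12 m13 m14 m15 m16 m17 m18 m19 m20 : ℝ) : ℝ :=
  wsq 3 (m16 - m4) + wsq 2 (m16 + m5) + wsq 14 (m16 + m6) + wsq 9 (m16 - m7)
    + wsq 37 (m16 - m8) + wsq 17 (m16 + m10) + wsq 43 (m16 - m11) + wsq 8 (m16 - m12)
    + wsq 21 (m16 + m13) + wsq 19 (m16 - m14) + wsq 11 (m16 - m15) + wsq 4 (m17 + m0)
    + wsq 10 (m17 - m1) + wsq 4 (m17 + m2) + wsq 1 (m17 + m3) + wsq 13 (m17 - m4)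
    + wsq 11 (m17 - m5) + wsq 24 (m17 + m6) + wsq 35 (m17 + m7) + wsq 42 (m17 - m8)
    + wsq 12 (m17 + m9) + wsq 15 (m17 - m10) + wsq 22 (m17 + m12) + wsq 50 (m17 + m13)
    + wsq 41 (m17 - m14) + wsq 18 (m17 - m15) + wsq 40 (m17 + m16) + wsq 6 (m18 + m0)
    + wsq 18 (m18 - m1) + wsq 15 (m18 - m2) + wsq 37 (m18 - m3) + wsq 11 (m18 - m4)
    + wsq 11 (m18 + m5) + wsq 22 (m18 - m6) + wsq 5 (m18 + m7) + wsq 33 (m18 + m8)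
    + wsq 12 (m18 + m10) + wsq 10 (m18 + m11) + wsq 10 (m18 + m12) + wsq 16 (m18 - m13)

theorem bs6_nonneg (m0 m1 m2 m3 m4 m5 m6 m7 m8 m9 m10 m11 m12 m13 m14 m15 m16 m17 m18 m19 m20 : ℝ) :
    0 ≤ bs6 m0 m1 m2 m3 m4 m5 m6 m7 m8 m9 m10 m11 m12 m13 m14 m15 m16 m17 m18 m19 m20 := by
  unfold bs6
  repeat (first | exact wsq_nonneg _ _ | refine add_nonneg ?_ (wsq_nonneg _ _))

/-- Part 7 of the sum-of-squares certificate. -/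
noncomputable def bs7 (m0 m1 m2 m3 m4 m5 m6 m7 m8 m9 m10 m11 m12 m13 m14 m15 m16 m17 m18 m19 m20 : ℝ) : ℝ :=
  wsq 7 (m18 + m14) + wsq 13 (m18 + m15) + wsq 36 (m18 - m16) + wsq 35 (m18 - m17)
    + wsq 11 (m19 - m0) + wsq 6 (m19 + m1) + wsq 17 (m19 - m2) + wsq 11 (m19 + m3)
    + wsq 13 (m19 + m4) + wsq 13 (m19 - m5) + wsq 12 (m19 - m6) + wsq 22 (m19 + m8)
    + wsq 24 (m19 + m9) + wsq 1 (m19 - m10) + wsq 21 (m19 - m11) + wsq 14 (m19 - m12)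
    + wsq 20 (m19 + m13) + wsq 6 (m19 - m14) + wsq 16 (m19 + m15) + wsq 21 (m19 + m16)
    + wsq 1 (m19 + m17) + wsq 19 (m19 + m18) + wsq 6 (m20 + m0) + wsq 16 (m20 - m1)
    + wsq 1 (m20 - m2) + wsq 33 (m20 - m3) + wsq 34 (m20 + m4) + wsq 1 (m20 - m5)
    + wsq 8 (m20 - m6) + wsq 12 (m20 + m7) + wsq 13 (m20 - m8) + wsq 27 (m20 + m9)
    + wsq 5 (m20 + m10) + wsq 37 (m20 - m11) + wsq 9 (m20 + m12) + wsq 22 (m20 + m13)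
    + wsq 12 (m20 + m14) + wsq 2 (m20 + m15) + wsq 15 (m20 + m16) + wsq 24 (m20 + m17)

theorem bs7_nonneg (m0 m1 m2 m3 m4 m5 m6 m7 m8 m9 m10 m11 m12 m13 m14 m15 m16 m17 m18 m19 m20 : ℝ) :
    0 ≤ bs7 m0 m1 m2 m3 m4 m5 m6 m7 m8 m9 m10 m11 m12 m13 m14 m15 m16 m17 m18 m19 m20 := by
  unfold bs7
  repeat (first | exact wsq_nonneg _ _ | refine add_nonneg ?_ (wsq_nonneg _ _))

/-- Part 8 of the sum-of-squares certificate. -/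
noncomputable def bs8 (m0 m1 m2 m3 m4 m5 m6 m7 m8 m9 m10 m11 m12 m13 m14 m15 m16 m17 m18 m19 m20 : ℝ) : ℝ :=
  wsq 1 (m20 + m18) + wsq 14 (m20 - m19) + wsq 185 m0 + wsq 530 m1
    + wsq 608 m2 + wsq 818 m3 + wsq 1181 m4 + wsq 918 m5
    + wsq 797 m6 + wsq 1657 m7 + wsq 1687 m8 + wsq 735 m9
    + wsq 594 m10 + wsq 1294 m11 + wsq 1726 m12 + wsq 1283 m13
    + wsq 567 m14 + wsq 14 m15 + wsq 536 m16 + wsq 759 m17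
    + wsq 824 m18 + wsq 507 m19

theorem bs8_nonneg (m0 m1 m2 m3 m4 m5 m6 m7 m8 m9 m10 m11 m12 m13 m14 m15 m16 m17 m18 m19 m20 : ℝ) :
    0 ≤ bs8 m0 m1 m2 m3 m4 m5 m6 m7 m8 m9 m10 m11 m12 m13 m14 m15 m16 m17 m18 m19 m20 := by
  unfold bs8
  repeat (first | exact wsq_nonneg _ _ | refine add_nonneg ?_ (wsq_nonneg _ _))

set_option maxHeartbeats 4000000 in
theorem boy_cert (x y z : ℝ)
    (h0 : 3*x^7 + x^6*y + 3*x^6*z - 9*x^5*y^2 + 20*x^5*y*z - 15*x^5*z^2 + 23*x^4*y^3 + 2*x^4*y^2*z + 14*x^4*y*z^2 - 7*x^4*z^3 + 27*x^3*y^4 + 54*x^3*y^3*z + 81*x^3*y^2*z^2 + 2*x^3*y*z^3 - 5*x^3*z^4 + 9*x^2*y^5 - x^2*y^4*z + 24*x^2*y^3*z^2 - 24*x^2*y^2*z^3 + 5*x^2*y*z^4 + 3*x^2*z^5 - x*y^6 + 2*x*y^5*z - 22*x*y^4*z^2 + 16*x*y^3*z^3 - 16*x*y^2*z^4 + 14*x*y*z^5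 + 5*x*z^6 - y^7 - 12*y^5*z^2 - 9*y^4*z^3 - 23*y^3*z^4 - 12*y^2*z^5 - 8*y*z^6 + z^7 = 0)
    (h1 : x^7 + 5*x^6*y - 8*x^6*z + 3*x^5*y^2 + 14*x^5*y*z - 12*x^5*z^2 - 5*x^4*y^3 + 5*x^4*y^2*z - 16*x^4*y*z^2 - 23*x^4*z^3 - 7*x^3*y^4 + 2*x^3*y^3*z - 24*x^3*y^2*z^2 + 16*x^3*y*z^3 - 9*x^3*z^4 - 15*x^2*y^5 + 14*x^2*y^4*z + 81*x^2*y^3*z^2 + 24*x^2*y^2*z^3 - 22*x^2*y*z^4 - 12*x^2*z^5 + 3*x*y^6 + 20*x*y^5*z + 2*x*y^4*z^2 + 54*x*y^3*z^3 - x*y^2*z^4 + 2*x*y*z^5 + 3*y^7 + y^6*z - 9*y^5*z^2 + 23*y^4*z^3 + 27*y^3*z^4 + 9*y^2*z^5 - y*z^6 - z^7 = 0)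
    (h2 : -x^7 - x^6*z - 12*x^5*y^2 + 2*x^5*y*z + 9*x^5*z^2 - 9*x^4*y^3 - 22*x^4*y^2*z - x^4*y*z^2 + 27*x^4*z^3 - 23*x^3*y^4 + 16*x^3*y^3*z + 24*x^3*y^2*z^2 + 54*x^3*y*z^3 + 23*x^3*z^4 - 12*x^2*y^5 - 16*x^2*y^4*z - 24*x^2*y^3*z^2 + 81*x^2*y^2*z^3 + 2*x^2*y*z^4 - 9*x^2*z^5 - 8*x*y^6 + 14*x*y^5*z + 5*x*y^4*z^2 + 2*x*y^3*z^3 + 14*x*y^2*z^4 + 20*x*y*z^5 + x*z^6 + y^7 + 5*y^6*z + 3*y^5*z^2 - 5*y^4*z^3 - 7*y^3*z^4 - 15*y^2*z^5 + 3*y*z^6 + 3*z^7 = 0)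
    : x = 0 ∧ y = 0 ∧ z = 0 := by
  obtain ⟨m0, k0⟩ : ∃ m : ℝ, m = x^5 := ⟨_, rfl⟩
  obtain ⟨m1, k1⟩ : ∃ m : ℝ, m = x^4*y := ⟨_, rfl⟩
  obtain ⟨m2, k2⟩ : ∃ m : ℝ, m = x^4*z := ⟨_, rfl⟩
  obtain ⟨m3, k3⟩ : ∃ m : ℝ, m = x^3*y^2 := ⟨_, rfl⟩
  obtain ⟨m4, k4⟩ : ∃ m : ℝ, m = x^3*y*z := ⟨_, rfl⟩
  obtain ⟨m5, k5⟩ : ∃ m : ℝ, m = x^3*z^2 := ⟨_, rfl⟩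
  obtain ⟨m6, k6⟩ : ∃ m : ℝ, m = x^2*y^3 := ⟨_, rfl⟩
  obtain ⟨m7, k7⟩ : ∃ m : ℝ, m = x^2*y^2*z := ⟨_, rfl⟩
  obtain ⟨m8, k8⟩ : ∃ m : ℝ, m = x^2*y*z^2 := ⟨_, rfl⟩
  obtain ⟨m9, k9⟩ : ∃ m : ℝ, m = x^2*z^3 := ⟨_, rfl⟩
  obtain ⟨m10, k10⟩ : ∃ m : ℝ, m = x*y^4 := ⟨_, rfl⟩
  obtain ⟨m11, k11⟩ : ∃ m : ℝ, m = x*y^3*z := ⟨_, rfl⟩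
  obtain ⟨m12, k12⟩ : ∃ m : ℝ, m = x*y^2*z^2 := ⟨_, rfl⟩
  obtain ⟨m13, k13⟩ : ∃ m : ℝ, m = x*y*z^3 := ⟨_, rfl⟩
  obtain ⟨m14, k14⟩ : ∃ m : ℝ, m = x*z^4 := ⟨_, rfl⟩
  obtain ⟨m15, k15⟩ : ∃ m : ℝ, m = y^5 := ⟨_, rfl⟩
  obtain ⟨m16, k16⟩ : ∃ m : ℝ, m = y^4*z := ⟨_, rfl⟩
  obtain ⟨m17, k17⟩ : ∃ m : ℝ, m = y^3*z^2 := ⟨_, rfl⟩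
  obtain ⟨m18, k18⟩ : ∃ m : ℝ, m = y^2*z^3 := ⟨_, rfl⟩
  obtain ⟨m19, k19⟩ : ∃ m : ℝ, m = y*z^4 := ⟨_, rfl⟩
  obtain ⟨m20, k20⟩ : ∃ m : ℝ, m = z^5 := ⟨_, rfl⟩
  have p0 := bs0_nonneg m0 m1 m2 m3 m4 m5 m6 m7 m8 m9 m10 m11 m12 m13 m14 m15 m16 m17 m18 m19 m20
  have p1 := bs1_nonneg m0 m1 m2 m3 m4 m5 m6 m7 m8 m9 m10 m11 m12 m13 m14 m15 m16 m17 m18 m19 m20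
  have p2 := bs2_nonneg m0 m1 m2 m3 m4 m5 m6 m7 m8 m9 m10 m11 m12 m13 m14 m15 m16 m17 m18 m19 m20
  have p3 := bs3_nonneg m0 m1 m2 m3 m4 m5 m6 m7 m8 m9 m10 m11 m12 m13 m14 m15 m16 m17 m18 m19 m20
  have p4 := bs4_nonneg m0 m1 m2 m3 m4 m5 m6 m7 m8 m9 m10 m11 m12 m13 m14 m15 m16 m17 m18 m19 m20
  have p5 := bs5_nonneg m0 m1 m2 m3 m4 m5 m6 m7 m8 m9 m10 m11 m12 m13 m14 m15 m16 m17 m18 m19 m20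
  have p6 := bs6_nonneg m0 m1 m2 m3 m4 m5 m6 m7 m8 m9 m10 m11 m12 m13 m14 m15 m16 m17 m18 m19 m20
  have p7 := bs7_nonneg m0 m1 m2 m3 m4 m5 m6 m7 m8 m9 m10 m11 m12 m13 m14 m15 m16 m17 m18 m19 m20
  have p8 := bs8_nonneg m0 m1 m2 m3 m4 m5 m6 m7 m8 m9 m10 m11 m12 m13 m14 m15 m16 m17 m18 m19 m20
  have key : 53*(x^10+y^10+z^10) + (bs0 m0 m1 m2 m3 m4 m5 m6 m7 m8 m9 m10 m11 m12 m13 m14 m15 m16 m17 m18 m19 m20 + bs1 m0 m1 m2 m3 m4 m5 m6 m7 m8 m9 m10 m11 m12 m13 m14 m15 m16 m17 m18 m19 m20 + bs2 m0 m1 m2 m3 m4 m5 m6 m7 m8 m9 m10 m11 m12 m13 m14 m15 m16 m17 m18 m19 m20 + bs3 m0 m1 m2 m3 m4 m5 m6 m7 m8 m9 m10 m11 m12 m13 m14 m15 m16 m17 m18 m19 m20 + bs4 m0 m1 m2 m3 m4 m5 m6 m7 m8 m9 m10 m11 m12 m13 m14 m15 m16 m17 m18 m19 m20 + bs5 m0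 m1 m2 m3 m4 m5 m6 m7 m8 m9 m10 m11 m12 m13 m14 m15 m16 m17 m18 m19 m20 + bs6 m0 m1 m2 m3 m4 m5 m6 m7 m8 m9 m10 m11 m12 m13 m14 m15 m16 m17 m18 m19 m20 + bs7 m0 m1 m2 m3 m4 m5 m6 m7 m8 m9 m10 m11 m12 m13 m14 m15 m16 m17 m18 m19 m20 + bs8 m0 m1 m2 m3 m4 m5 m6 m7 m8 m9 m10 m11 m12 m13 m14 m15 m16 m17 m18 m19 m20) = 0 := by
    simp only [bs0, bs1, bs2, bs3, bs4, bs5, bs6, bs7, bs8, wsq, k0, k1, k2, k3, k4, k5, k6, k7, k8, k9, k10, k11, k12, k13, k14, k15, k16, k17, k18, k19, k20]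
    linear_combination 18*(14*x^3 - 24*x^2*y + 5*x^2*z + 11*x*y^2 + 28*x*y*z + 16*x*z^2 - 13*y^3 + 19*y^2*z - 40*y*z^2)*h0 + 18*(16*x^2*y - 40*x^2*z + 5*x*y^2 + 28*x*y*z + 19*x*z^2 + 14*y^3 - 24*y^2*z + 11*y*z^2 - 13*z^3)*h1 + 18*(-13*x^3 + 19*x^2*y + 11*x^2*z - 40*x*y^2 + 28*x*y*z - 24*x*z^2 + 16*y^2*z + 5*y*z^2 + 14*z^3)*h2
  have qx : 0 ≤ x^10 := by positivity
  have qy : 0 ≤ y^10 := by positivity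
  have qz : 0 ≤ z^10 := by positivity
  refine ⟨?_, ?_, ?_⟩ <;> refine pow_eq_zero_iff (n := 10) (by norm_num) |>.1 ?_ <;> linarith

noncomputable def bF (x y z : ℝ) : ℝ :=
  12 * (x^2 * (x^2 + y^2 + z^2) + y * z * (y^2 - z^2)) + (x + y + z)^4

noncomputable def bX (x y z : ℝ) : ℝ :=
  12 * (2 * x * (x^2 + y^2 + z^2) + 2 * x^3) + 4 * (x + y + z)^3

noncomputable def bY (x y z : ℝ) : ℝ :=
  12 * (2 * x^2 * y + 3 * y^2 * z - z^3) + 4 * (x + y + z)^3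

noncomputable def bZ (x y z : ℝ) : ℝ :=
  12 * (2 * x^2 * z + y^3 - 3 * y * z^2) + 4 * (x + y + z)^3

theorem det3_aux (a1 a2 a3 b1 b2 b3 c1 c2 c3 p q r : ℝ)
    (ha : a1*p + a2*q + a3*r = 0) (hb : b1*p + b2*q + b3*r = 0) (hc : c1*p + c2*q + c3*r = 0)
    (h : ¬ (p = 0 ∧ q = 0 ∧ r = 0)) :
    a1*(b2*c3-b3*c2) - a2*(b1*c3-b3*c1) + a3*(b1*c2-b2*c1) = 0 := by
  by_contra hd
  apply h
  refine ⟨?_, ?_, ?_⟩ <;> refine (mul_eq_zero.1 ?_).resolve_left hd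
  · linear_combination (b2*c3-b3*c2)*ha - (a2*c3-a3*c2)*hb + (a2*b3-a3*b2)*hc
  · linear_combination -(b1*c3-b3*c1)*ha + (a1*c3-a3*c1)*hb - (a1*b3-a3*b1)*hc
  · linear_combination (b1*c2-b2*c1)*ha - (a1*c2-a2*c1)*hb + (a1*b2-a2*b1)*hc

set_option maxHeartbeats 4000000 in
theorem boy_rank (x y z p q r : ℝ)
    (e0 : bX x y z * p + bY x y z * q + bZ x y z * r = 0)
    (e1 : bX y z x * q + bY y z x * r + bZ y z x * p = 0)
    (e2 : bX z x y * r + bY z x y * p + bZ z x y * q = 0)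
    (e3 : x * p + y * q + z * r = 0)
    (hv : ¬ (x = 0 ∧ y = 0 ∧ z = 0)) : p = 0 ∧ q = 0 ∧ r = 0 := by
  by_contra h
  have e1' : bZ y z x * p + bX y z x * q + bY y z x * r = 0 := by linear_combination e1
  have e2' : bY z x y * p + bZ z x y * q + bX z x y * r = 0 := by linear_combination e2
  have d0 := det3_aux _ _ _ _ _ _ _ _ _ p q r e1' e2' e3 h
  have d1 := det3_aux _ _ _ _ _ _ _ _ _ p q r e2' e0 e3 h
  have d2 := det3_aux _ _ _ _ _ _ _ _ _ p q r e0 e1' e3 h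
  simp only [bX, bY, bZ] at d0 d1 d2
  refine hv (boy_cert x y z ?_ ?_ ?_)
  · linear_combination d0 / 48
  · linear_combination d1 / 48
  · linear_combination d2 / 48

abbrev E3 := EuclideanSpace ℝ (Fin 3)

/-- Coordinate projection. -/
noncomputable abbrev prj (i : Fin 3) : E3 →L[ℝ] ℝ := EuclideanSpace.proj i

/-- The derivative of the quartic. -/
noncomputable def bD (i j k : Fin 3) (v : E3) : E3 →L[ℝ] ℝ :=
  bX (v i) (v j) (v k) • prj i + bY (v i) (v j) (v k) • prj j + bZ (v i) (v j) (v k) • prj k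

theorem bF_deriv (i j k : Fin 3) (v : E3) :
    HasStrictFDerivAt (fun v : E3 => bF (v i) (v j) (v k))
      (bD i j k v) v := by
  have hp : ∀ i : Fin 3, HasStrictFDerivAt (fun v : E3 => v i)
      (prj i) v :=
    fun i => (prj i).hasStrictFDerivAt
  have hx := hp i
  have hy := hp j
  have hz := hp k
  have := (((hx.pow 2).mul (((hx.pow 2).add (hy.pow 2)).add (hz.pow 2))).add
    ((hy.mul hz).mul ((hy.pow 2).sub (hz.pow 2)))).const_mul 12 |>.add
    (((hx.add hy).add hz).pow 4)
  refine (this.congr_fderiv ?_)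
  ext h
  simp [bD, bX, bY, bZ]
  ring

/-- The map on `ℝ³`: the quartic Boy map and the squared norm. -/
noncomputable def bPhi (v : E3) : Fin 4 → ℝ :=
  ![bF (v 0) (v 1) (v 2), bF (v 1) (v 2) (v 0), bF (v 2) (v 0) (v 1), v 0 ^ 2 + v 1 ^ 2 + v 2 ^ 2]

theorem bPhi_inj (v : E3) (hv : v ≠ 0) : ∃ W : Set E3, IsOpen W ∧ v ∈ W ∧ Set.InjOn bPhi W := by
  have hp : ∀ i : Fin 3, HasStrictFDerivAt (fun v : E3 => v i)
      (prj i) v :=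
    fun i => (prj i).hasStrictFDerivAt
  have h3 := (((hp 0).pow 2).add ((hp 1).pow 2)).add ((hp 2).pow 2)
  obtain ⟨D, hD, hinj⟩ : ∃ D : E3 →L[ℝ] (Fin 4 → ℝ), HasStrictFDerivAt bPhi D v ∧
      Function.Injective D := by
    refine ⟨ContinuousLinearMap.pi ![bD 0 1 2 v, bD 1 2 0 v, bD 2 0 1 v,
      (2 • v 0 ^ (2 - 1)) • prj 0 + (2 • v 1 ^ (2 - 1)) • prj 1 + (2 • v 2 ^ (2 - 1)) • prj 2], hasStrictFDerivAt_pi'.2 ?_, ?_⟩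
    · intro i
      fin_cases i
      · exact bF_deriv 0 1 2 v
      · exact bF_deriv 1 2 0 v
      · exact bF_deriv 2 0 1 v
      · exact h3
    · rw [injective_iff_map_eq_zero]
      intro h hh
      have e0 := congrFun hh 0
      have e1 := congrFun hh 1
      have e2 := congrFun hh 2
      have e3 := congrFun hh 3
      simp [bD] at e0 e1 e2 e3
      have := boy_rank (v 0) (v 1) (v 2) (h 0) (h 1) (h 2) e0 e1 e2 (by linear_combination e3/2) (by
        rintro ⟨a, b, c⟩
        apply hv
        ext i; fin_cases i <;> simp [a, b, c])
      ext i; fin_cases i <;> simp [this]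
  obtain ⟨g, hg⟩ := (D : E3 →ₗ[ℝ] (Fin 4 → ℝ)).exists_leftInverse_of_injective (LinearMap.ker_eq_bot.2 hinj)
  let G : (Fin 4 → ℝ) →L[ℝ] E3 := LinearMap.toContinuousLinearMap g
  have hG : HasStrictFDerivAt (G ∘ bPhi) ((ContinuousLinearEquiv.refl ℝ E3 : E3 ≃L[ℝ] E3) : E3 →L[ℝ] E3) v := by
    refine (G.hasStrictFDerivAt.comp v hD).congr_fderiv ?_
    ext1 h
    exact LinearMap.congr_fun hg h
  refine ⟨(hG.toOpenPartialHomeomorph _).source, (hG.toOpenPartialHomeomorph _).open_source,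
    hG.mem_toOpenPartialHomeomorph_source, ?_⟩
  intro a ha b hb hab
  apply (hG.toOpenPartialHomeomorph _).injOn ha hb
  simp [hab]

/-- The Boy map on vectors, homogeneous of degree zero. -/
noncomputable def bG (v : E3) : E3 :=
  !₂[bF (v 0) (v 1) (v 2) / (v 0 ^ 2 + v 1 ^ 2 + v 2 ^ 2) ^ 2,
     bF (v 1) (v 2) (v 0) / (v 0 ^ 2 + v 1 ^ 2 + v 2 ^ 2) ^ 2,
     bF (v 2) (v 0) (v 1) / (v 0 ^ 2 + v 1 ^ 2 + v 2 ^ 2) ^ 2]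

theorem nsq_eq (v : E3) : v 0 ^ 2 + v 1 ^ 2 + v 2 ^ 2 = ‖v‖ ^ 2 := by
  rw [EuclideanSpace.norm_sq_eq, Fin.sum_univ_three]; simp

theorem bF_smul (c x y z : ℝ) : bF (c * x) (c * y) (c * z) = c ^ 4 * bF x y z := by
  unfold bF; ring

theorem bG_smul (c : ℝ) (hc : c ≠ 0) (v : E3) : bG (c • v) = bG v := by
  have : (c * v 0) ^ 2 + (c * v 1) ^ 2 + (c * v 2) ^ 2
    = c ^ 2 * (v 0 ^ 2 + v 1 ^ 2 + v 2 ^ 2) := by ring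
  unfold bG
  simp only [PiLp.smul_apply, smul_eq_mul, bF_smul, this]
  simp only [mul_pow (c ^ 2), ← pow_mul]
  norm_num only
  simp only [mul_div_mul_left _ _ (pow_ne_zero 4 hc)]

theorem bG_cont : Continuous (fun v : {v : E3 // v ≠ 0} => bG v.1) := by
  have hne : ∀ v : {v : E3 // v ≠ 0}, (v.1 0 ^ 2 + v.1 1 ^ 2 + v.1 2 ^ 2) ^ 2 ≠ 0 := by
    intro v
    rw [nsq_eq]
    have := norm_ne_zero_iff.2 v.2
    positivity
  have hc : ∀ i j k : Fin 3, Continuous (fun v : {v : E3 // v ≠ 0} => bF (v.1 i) (v.1 j) (v.1 k) /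
      (v.1 0 ^ 2 + v.1 1 ^ 2 + v.1 2 ^ 2) ^ 2) := by
    intro i j k
    refine Continuous.div ?_ (by fun_prop) hne
    unfold bF
    fun_prop
  unfold bG
  refine (PiLp.continuous_toLp 2 _).comp (continuous_pi fun i => ?_)
  fin_cases i
  · exact hc 0 1 2
  · exact hc 1 2 0
  · exact hc 2 0 1

theorem bPhi_of_bG (a b : E3) (ha : ‖a‖ = 1) (hb : ‖b‖ = 1) (h : bG a = bG b) :
    bPhi a = bPhi b := by
  have h0 := congrArg (fun w : E3 => w 0) h
  have h1 := congrArg (fun w : E3 => w 1) h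
  have h2 := congrArg (fun w : E3 => w 2) h
  simp [bG, nsq_eq, ha, hb] at h0 h1 h2
  simp [bPhi, nsq_eq, ha, hb, h0, h1, h2]

/-- **Boy's theorem** (topological content): there is a continuous map from the
real projective plane `ℝP²` to `ℝ³` that is locally injective: every point has
an open neighborhood on which the map is injective. -/
theorem boy_surface_locally_injective :
    ∃ g : ℙ ℝ (EuclideanSpace ℝ (Fin 3)) → EuclideanSpace ℝ (Fin 3),
      Continuous g ∧
      ∀ p : ℙ ℝ (EuclideanSpace ℝ (Fin 3)),
        ∃ U : Set (ℙ ℝ (EuclideanSpace ℝ (Fin 3))),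
          IsOpen U ∧ p ∈ U ∧ Set.InjOn g U := by
  have hwd : ∀ a b : {v : E3 // v ≠ 0}, ∀ t : ℝ, a.1 = t • b.1 → bG a.1 = bG b.1 := by
    intro a b t h
    rw [h]
    apply bG_smul
    rintro rfl
    exact a.2 (by simpa using h)
  have hmk : ∀ v (hv : v ≠ 0), Projectivization.lift (fun v : {v : E3 // v ≠ 0} => bG v.1) hwd
      (Projectivization.mk ℝ v hv) = bG v := fun v hv => Projectivization.lift_mk _ hwd v hv
  refine ⟨Projectivization.lift (fun v => bG v.1) hwd, ?_, ?_⟩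
  · exact Continuous.quotient_lift bG_cont _
  · intro p
    induction p using Projectivization.ind with
    | h v hv =>
    have hn : ∀ v : E3, v ≠ 0 → ‖(‖v‖⁻¹ • v)‖ = 1 := fun v hv => by
      rw [norm_smul, norm_inv, norm_norm, inv_mul_cancel₀ (norm_ne_zero_iff.2 hv)]
    have hun : ‖v‖⁻¹ • v ≠ 0 := by
      intro h
      have := hn v hv
      rw [h] at this
      simp at this
    obtain ⟨W, hWo, hvW, hinj⟩ := bPhi_inj _ hun
    have hc : Continuous (fun v : {v : E3 // v ≠ 0} => ‖v.1‖⁻¹ • v.1) := by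
      refine Continuous.smul (Continuous.inv₀ continuous_subtype_val.norm ?_) continuous_subtype_val
      intro v
      exact norm_ne_zero_iff.2 v.2
    refine ⟨(fun w : {v : E3 // v ≠ 0} => Projectivization.mk ℝ w.1 w.2) ''
      ((fun v : {v : E3 // v ≠ 0} => ‖v.1‖⁻¹ • v.1) ⁻¹' W), ?_, ⟨⟨v, hv⟩, hvW, rfl⟩, ?_⟩
    · refine isOpen_coinduced.2 ?_
      have : (Quotient.mk'' ⁻¹' ((fun w : {v : E3 // v ≠ 0} => Projectivization.mk ℝ w.1 w.2) ''
          ((fun v : {v : E3 // v ≠ 0} => ‖v.1‖⁻¹ • v.1) ⁻¹' W)) : Set {v : E3 // v ≠ 0})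
          = (fun v : {v : E3 // v ≠ 0} => ‖v.1‖⁻¹ • v.1) ⁻¹' W
            ∪ (fun v : {v : E3 // v ≠ 0} => -(‖v.1‖⁻¹ • v.1)) ⁻¹' W := by
        ext w
        constructor
        · rintro ⟨u, hu, huw⟩
          have huw' : Projectivization.mk ℝ u.1 u.2 = Projectivization.mk ℝ w.1 w.2 := huw
          rw [Projectivization.mk_eq_mk_iff'] at huw'
          obtain ⟨t, ht⟩ := huw'
          have ht0 : t ≠ 0 := by
            rintro rfl
            exact u.2 (by simpa using ht.symm)
          simp only [Set.mem_preimage, ← ht, norm_smul, smul_smul, mul_inv] at hu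
          rcases lt_or_gt_of_ne ht0 with h | h
          · right
            simp only [Set.mem_preimage]
            convert hu using 1
            rw [← neg_smul]
            congr 1
            rw [Real.norm_eq_abs, abs_of_neg h]
            field_simp
          · left
            simp only [Set.mem_preimage]
            convert hu using 1
            congr 1
            rw [Real.norm_eq_abs, abs_of_pos h]
            field_simp
        · rintro (h | h)
          · exact ⟨w, h, rfl⟩
          · refine ⟨⟨-w.1, neg_ne_zero.2 w.2⟩, ?_, ?_⟩
            · simpa using h
            · change Projectivization.mk ℝ (-w.1) _ = Projectivization.mk ℝ w.1 w.2
              rw [Projectivization.mk_eq_mk_iff']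
              exact ⟨-1, by simp⟩
      exact this ▸ (hWo.preimage hc).union (hWo.preimage hc.neg)
    · rintro _ ⟨a, ha, rfl⟩ _ ⟨b, hb, rfl⟩ hab
      simp only [hmk] at hab
      have ia : ‖a.1‖⁻¹ ≠ 0 := inv_ne_zero (norm_ne_zero_iff.2 a.2)
      have ib : ‖b.1‖⁻¹ ≠ 0 := inv_ne_zero (norm_ne_zero_iff.2 b.2)
      rw [← bG_smul _ ia, ← bG_smul _ ib b.1] at hab
      have : ‖a.1‖⁻¹ • a.1 = ‖b.1‖⁻¹ • b.1 := hinj ha hb (bPhi_of_bG _ _ (hn _ a.2) (hn _ b.2) hab)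
      simp only
      rw [Projectivization.mk_eq_mk_iff']
      refine ⟨‖a.1‖ * ‖b.1‖⁻¹, ?_⟩
      rw [mul_smul, ← this, smul_smul, mul_inv_cancel₀ (norm_ne_zero_iff.2 a.2), one_smul]
end
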